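/- Let n ≥ 0 be an integer and let q, b, λ be complex numbers with 0 < |q| < 1, b ≠ 0, and 1 + b q^k ≠ 0 for all 1 ≤ k ≤ n. Then ∑_{m=0}^{n} [n choose m]_q · λ^m q^{m²} / (-bq;q)_m = (1/(-bq;q)_n) · ∑_{m=0}^{n} [n choose m]_q · (-λ/b;q)_m b^m q^{m(m+1)/2}. -/

import Mathlib

open scoped BigOperators

/-- The finite q-Pochhammer symbol `(a;q)_n`. -/
noncomputable def qPoch (a q : ℂ) (n : ℕ) : ℂ := ∏ k ∈ Finset.range n, (1 - a * q ^ k)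

/-- The Gaussian binomial coefficient `[N choose n]_q`. -/
noncomputable def qbinom (q : ℂ) (N n : ℕ) : ℂ :=
  if n ≤ N then qPoch q q N / (qPoch q q n * qPoch q q (N - n)) else 0

theorem qPoch_self_ne_zero {q : ℂ} (hq1 : ‖q‖ < 1) (n : ℕ) : qPoch q q n ≠ 0 := by
  refine Finset.prod_ne_zero_iff.mpr fun k _ h => ?_
  have h1 : ‖q ^ (k + 1)‖ < 1 := by
    rw [norm_pow]
    exact pow_lt_one₀ (norm_nonneg q) hq1 k.succ_ne_zero
  have h2 : q ^ (k + 1) = 1 := by rw [pow_succ']; exact (sub_eq_zero.mp h).symm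
  rw [h2, norm_one] at h1
  exact lt_irrefl _ h1

theorem qPoch_succ (a q : ℂ) (n : ℕ) : qPoch a q (n + 1) = qPoch a q n * (1 - a * q ^ n) :=
  Finset.prod_range_succ _ _

theorem qPoch_add (a q : ℂ) (m n : ℕ) :
    qPoch a q (m + n) = qPoch a q m * qPoch (a * q ^ m) q n := by
  simp only [qPoch, Finset.prod_range_add, pow_add, mul_assoc]

theorem qbinom_add {q : ℂ} (m n : ℕ) :
    qbinom q (m + n) m = qPoch q q (m + n) / (qPoch q q m * qPoch q q n) := by
  simp [qbinom]

theorem qbinom_zero_right {q : ℂ} (hq1 : ‖q‖ < 1) (n : ℕ) : qbinom q n 0 = 1 := by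
  simp [qbinom, qPoch_self_ne_zero hq1, show qPoch q q 0 = 1 from Finset.prod_range_zero _]

theorem qbinom_self {q : ℂ} (hq1 : ‖q‖ < 1) (n : ℕ) : qbinom q n n = 1 := by
  simp [qbinom, qPoch_self_ne_zero hq1, show qPoch q q 0 = 1 from Finset.prod_range_zero _]

theorem qbinom_eq_zero_of_lt {q : ℂ} {n m : ℕ} (h : n < m) : qbinom q n m = 0 :=
  if_neg h.not_ge

/-- The Pascal rule for Gaussian binomial coefficients. -/
theorem qbinom_succ_succ {q : ℂ} (hq1 : ‖q‖ < 1) {n j : ℕ} (hj : j ≤ n) :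
    qbinom q (n + 1) (j + 1) = qbinom q n (j + 1) + q ^ (n - j) * qbinom q n j := by
  obtain rfl | hlt := hj.eq_or_lt
  · simp [qbinom_self hq1, qbinom_eq_zero_of_lt]
  obtain ⟨d, rfl⟩ := Nat.exists_eq_add_of_lt hlt
  have e1 : j + d + 1 + 1 = (j + 1) + (d + 1) := by ring
  have e2 : qbinom q (j + d + 1) (j + 1) =
      qPoch q q (j + d + 1) / (qPoch q q (j + 1) * qPoch q q d) := by
    rw [show j + d + 1 = j + 1 + d by ring, qbinom_add]
  have e3 : qbinom q (j + d + 1) j =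
      qPoch q q (j + d + 1) / (qPoch q q j * qPoch q q (d + 1)) := by
    rw [add_assoc, qbinom_add]
  rw [e2, e3, e1, qbinom_add, ← e1, show j + d + 1 - j = d + 1 by lia, qPoch_succ q q (j + d + 1)]
  have hj := qPoch_self_ne_zero hq1 (j + 1)
  have hd := qPoch_self_ne_zero hq1 (d + 1)
  rw [qPoch_succ] at hj hd
  rw [qPoch_succ q q j, qPoch_succ q q d]
  have hj1 := left_ne_zero_of_mul hj
  have hj2 := right_ne_zero_of_mul hj
  have hd1 := left_ne_zero_of_mul hd
  have hd2 := right_ne_zero_of_mul hd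
  field_simp
  ring

/-- The finite `q`-binomial theorem. -/
theorem prod_add_mul_pow_eq_sum_qbinom {q : ℂ} (hq1 : ‖q‖ < 1) (x y : ℂ) (n : ℕ) :
    ∏ k ∈ Finset.range n, (x + y * q ^ k) =
      ∑ j ∈ Finset.range (n + 1), qbinom q n j * q ^ j.choose 2 * y ^ j * x ^ (n - j) := by
  induction n with
  | zero => simp [qbinom_self hq1]
  | succ n ih =>
    have hx : x * ∑ j ∈ Finset.range (n + 1), qbinom q n j * q ^ j.choose 2 * y ^ j * x ^ (n - j) =
        ∑ j ∈ Finset.range (n + 1),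
          qbinom q n (j + 1) * q ^ (j + 1).choose 2 * y ^ (j + 1) * x ^ (n - j) + x ^ (n + 1) := by
      have h := Finset.sum_range_succ'
        (fun j => qbinom q n j * q ^ j.choose 2 * y ^ j * x ^ (n + 1 - j)) (n + 1)
      rw [Finset.sum_range_succ, qbinom_eq_zero_of_lt n.lt_succ_self] at h
      simp only [Nat.add_sub_add_right, qbinom_zero_right hq1, zero_mul, add_zero] at h
      simp only [Nat.choose_zero_succ, pow_zero, one_mul, Nat.sub_zero] at h
      rw [← h, Finset.mul_sum]
      refine Finset.sum_congr rfl fun j hj => ?_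
      rw [Nat.succ_sub (Finset.mem_range_succ_iff.mp hj), pow_succ]
      ring
    rw [Finset.prod_range_succ, ih, mul_add, mul_comm _ x, hx, Finset.sum_range_succ' _ (n + 1),
      add_right_comm, Finset.sum_mul, ← Finset.sum_add_distrib]
    simp only [Nat.add_sub_add_right, qbinom_zero_right hq1, Nat.choose_zero_succ, pow_zero,
      one_mul, Nat.sub_zero]
    congr 1
    refine Finset.sum_congr rfl fun j hj => ?_
    have hjn := Finset.mem_range_succ_iff.mp hj
    have hq : q ^ n = q ^ (n - j) * q ^ j := by rw [← pow_add, Nat.sub_add_cancel hjn]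
    rw [qbinom_succ_succ hq1 hjn, Nat.choose_succ_succ' j 1, Nat.choose_one_right, hq]
    ring

theorem qbinom_mul_qbinom {q : ℂ} (hq1 : ‖q‖ < 1) {n j i : ℕ} (h : j + i ≤ n) :
    qbinom q n (j + i) * qbinom q (j + i) j = qbinom q n j * qbinom q (n - j) i := by
  obtain ⟨d, rfl⟩ := Nat.exists_eq_add_of_le h
  rw [qbinom_add, qbinom_add, add_assoc, Nat.add_sub_cancel_left, qbinom_add, qbinom_add]
  have h1 := qPoch_self_ne_zero hq1 j
  have h2 := qPoch_self_ne_zero hq1 i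
  have h3 := qPoch_self_ne_zero hq1 d
  have h4 := qPoch_self_ne_zero hq1 (j + i)
  have h5 := qPoch_self_ne_zero hq1 (i + d)
  field_simp

theorem choose_two_exponent (j i : ℕ) :
    (j + i + 1).choose 2 + j.choose 2 = j ^ 2 + i.choose 2 + (j + 1) * i := by
  have h (k : ℕ) : 2 * (k + 1).choose 2 = (k + 1) * k := by
    rw [Nat.choose_two_right, Nat.mul_div_cancel' (Nat.even_mul_pred_self (k + 1)).two_dvd,
      Nat.add_sub_cancel]
  have h1 := h (j + i)
  have h2 := h j
  have h3 := h i
  rw [Nat.choose_succ_succ' _ 1, Nat.choose_one_right] at h1 h2 h3 ⊢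
  nlinarith

/-- The polynomial form of the identity, with denominators cleared. -/
theorem sum_qbinom_mul_qPoch_eq {q : ℂ} (hq1 : ‖q‖ < 1) (b lam : ℂ) (n : ℕ) :
    ∑ m ∈ Finset.range (n + 1),
        qbinom q n m * (lam ^ m * q ^ (m ^ 2) * qPoch (-(b * q) * q ^ m) q (n - m)) =
      ∑ m ∈ Finset.range (n + 1), qbinom q n m *
        ((∏ k ∈ Finset.range m, (b + lam * q ^ k)) * q ^ (m + 1).choose 2) := by
  let f (j i : ℕ) : ℂ := qbinom q n (j + i) * qbinom q (j + i) j *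
    q ^ ((j + i + 1).choose 2 + j.choose 2) * lam ^ j * b ^ i
  trans ∑ m ∈ Finset.range (n + 1), ∑ i ∈ Finset.range (n + 1 - m), f m i
  · refine Finset.sum_congr rfl fun m hm => ?_
    have hmn := Finset.mem_range_succ_iff.mp hm
    have hP : qPoch (-(b * q) * q ^ m) q (n - m) =
        ∏ k ∈ Finset.range (n - m), (1 + b * q ^ (m + 1) * q ^ k) :=
      Finset.prod_congr rfl fun k _ => by ring
    rw [hP, prod_add_mul_pow_eq_sum_qbinom hq1, Nat.succ_sub hmn, Finset.mul_sum, Finset.mul_sum]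
    refine Finset.sum_congr rfl fun i hi => ?_
    have hin := Finset.mem_range_succ_iff.mp hi
    simp only [f]
    rw [qbinom_mul_qbinom hq1 (by lia), choose_two_exponent, mul_pow, ← pow_mul, pow_add, pow_add,
      one_pow]
    ring
  · rw [← Finset.sum_range_diag_flip]
    refine Finset.sum_congr rfl fun m _ => ?_
    rw [prod_add_mul_pow_eq_sum_qbinom hq1, Finset.sum_mul, Finset.mul_sum]
    refine Finset.sum_congr rfl fun j hj => ?_
    have hjm := Finset.mem_range_succ_iff.mp hj
    simp only [f]
    rw [Nat.add_sub_cancel' hjm, pow_add]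
    ring

theorem qPoch_neg_div_mul_pow {b : ℂ} (hb : b ≠ 0) (lam q : ℂ) (m : ℕ) :
    qPoch (-lam / b) q m * b ^ m = ∏ k ∈ Finset.range m, (b + lam * q ^ k) := by
  rw [qPoch, Finset.pow_eq_prod_const, ← Finset.prod_mul_distrib]
  refine Finset.prod_congr rfl fun k _ => ?_
  field_simp
  ring

theorem finite_srivastava_corollary (n : ℕ) (q b lam : ℂ) (hq0 : 0 < ‖q‖)
    (hq1 : ‖q‖ < 1) (hb : b ≠ 0)
    (hB : ∀ k : ℕ, 1 ≤ k → k ≤ n → 1 + b * q ^ k ≠ 0) :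
    ∑ m ∈ Finset.range (n + 1),
        qbinom q n m * (lam ^ m * q ^ (m ^ 2) / qPoch (-(b * q)) q m)
      = (1 / qPoch (-(b * q)) q n) *
          ∑ m ∈ Finset.range (n + 1),
            qbinom q n m * (qPoch (-lam / b) q m * b ^ m * q ^ (m * (m + 1) / 2)) := by
  have hne : qPoch (-(b * q)) q n ≠ 0 := by
    refine Finset.prod_ne_zero_iff.mpr fun k hk h => ?_
    refine hB (k + 1) k.succ_pos (Finset.mem_range.mp hk) ?_
    rw [← h]
    ring
  have hR : ∑ m ∈ Finset.range (n + 1),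
      qbinom q n m * (qPoch (-lam / b) q m * b ^ m * q ^ (m * (m + 1) / 2)) =
      ∑ m ∈ Finset.range (n + 1), qbinom q n m *
        ((∏ k ∈ Finset.range m, (b + lam * q ^ k)) * q ^ (m + 1).choose 2) := by
    refine Finset.sum_congr rfl fun m _ => ?_
    rw [qPoch_neg_div_mul_pow hb, Nat.choose_two_right, Nat.add_sub_cancel, mul_comm (m + 1) m]
  rw [hR, ← sum_qbinom_mul_qPoch_eq hq1, Finset.mul_sum]
  refine Finset.sum_congr rfl fun m hm => ?_
  obtain ⟨d, rfl⟩ := Nat.exists_eq_add_of_le (Finset.mem_range_succ_iff.mp hm)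
  rw [qPoch_add] at hne ⊢
  have h1 := left_ne_zero_of_mul hne
  have h2 := right_ne_zero_of_mul hne
  rw [Nat.add_sub_cancel_left]
  generalize qPoch (-(b * q) * q ^ m) q d = c at h2 ⊢
  field_simp
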